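/- arXiv:2311.14560 — 5 statements merged into one kernel-verified Lean document; each statement's English description precedes it below -/
import Mathlib

section
/- Let d ≥ 1 be an integer, let k ∈ ℤ^d with k ≠ 0, and let 0 < ε ≤ 1/4. Then ∫_{[0,1]^d} (1 + 2ε cos(2π k·x)) · log(1 + 2ε cos(2π k·x)) dx ≤ ε²·(1 + 8ε). -/
open MeasureTheory

lemma aux_cos (d : ℕ) (k : Fin d → ℤ) (hk : k ≠ 0) :
    (∫ x in Set.Icc (0 : Fin d → ℝ) 1,
        Real.cos (2 * Real.pi * ∑ i, (k i : ℝ) * x i)) = 0 := by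
  have hm : (volume : Measure (Fin d → ℝ)).restrict (Set.Icc (0 : Fin d → ℝ) 1)
      = Measure.pi (fun _ : Fin d => (volume : Measure ℝ).restrict (Set.Icc 0 1)) := by
    rw [volume_pi, ← Measure.restrict_pi_pi]
    congr 1
    exact (Set.pi_univ_Icc _ _).symm
  have hc : (∫ x in Set.Icc (0 : Fin d → ℝ) 1,
      Complex.exp (((2 * Real.pi * ∑ i, (k i : ℝ) * x i : ℝ) : ℂ) * Complex.I)) = 0 := by
    have h1 : ∀ x : Fin d → ℝ,
        Complex.exp (((2 * Real.pi * ∑ i, (k i : ℝ) * x i : ℝ) : ℂ) * Complex.I)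
        = ∏ i, Complex.exp ((2 * Real.pi * k i * Complex.I) * (x i : ℝ)) := by
      intro x
      rw [← Complex.exp_sum]
      congr 1
      push_cast
      rw [Finset.mul_sum, Finset.sum_mul]
      refine Finset.sum_congr rfl fun i _ => by ring
    simp_rw [h1]
    rw [hm, integral_fintype_prod_eq_prod (𝕜 := ℂ)
      (f := fun i (t : ℝ) => Complex.exp ((2 * Real.pi * k i * Complex.I) * (t : ℝ)))]
    obtain ⟨j, hj⟩ := Function.ne_iff.mp hk
    refine Finset.prod_eq_zero (Finset.mem_univ j) ?_
    rw [integral_Icc_eq_integral_Ioc, ← intervalIntegral.integral_of_le zero_le_one]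
    have hne : (2 * Real.pi * k j * Complex.I : ℂ) ≠ 0 := by
      have : (k j : ℂ) ≠ 0 := by exact_mod_cast hj
      have h2 : (Real.pi : ℂ) ≠ 0 := by exact_mod_cast Real.pi_ne_zero
      simp [this, h2]
    rw [integral_exp_mul_complex hne]
    have : Complex.exp (2 * Real.pi * k j * Complex.I * ((1 : ℝ) : ℂ)) = 1 := by
      rw [Complex.exp_eq_one_iff]
      exact ⟨k j, by push_cast; ring⟩
    rw [this]
    simp
  have hi : IntegrableOn (fun x : Fin d → ℝ =>
      Complex.exp (((2 * Real.pi * ∑ i, (k i : ℝ) * x i : ℝ) : ℂ) * Complex.I))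
      (Set.Icc (0 : Fin d → ℝ) 1) :=
    (Continuous.continuousOn (by fun_prop)).integrableOn_compact isCompact_Icc
  have h3 := integral_re (𝕜 := ℂ) hi
  rw [hc] at h3
  simpa [Complex.exp_ofReal_mul_I_re, -Complex.ofReal_mul, -Complex.ofReal_sum] using h3

lemma aux_log (u : ℝ) (h1 : -(1/2) ≤ u) (h2 : u ≤ 1/2) :
    (1 + u) * Real.log (1 + u) ≤ u + u^2/2 + 2 * |u| * u^2 := by
  have hu : |u| ≤ 1/2 := abs_le.mpr ⟨by linarith, h2⟩
  have h := Real.abs_log_sub_add_sum_range_le (x := -u) (by rw [abs_neg]; linarith) 3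
  have h := (abs_le.mp h).2
  simp only [Finset.sum_range_succ, Finset.sum_range_zero, abs_neg, sub_neg_eq_add] at h
  norm_num at h
  have hb : |u|^4 / (1 - |u|) * (1 + u) ≤ 3 / 2 * |u|^3 := by
    have hp : 0 < 1 - |u| := by linarith
    rw [div_mul_eq_mul_div, div_le_iff₀ hp]
    have h0 := abs_nonneg u
    have h3 : |u| * (1+u) ≤ 3/2 * (1 - |u|) := by
      nlinarith [le_abs_self u]
    nlinarith [mul_le_mul_of_nonneg_left h3 (pow_nonneg h0 3)]
  have hlog : Real.log (1+u) ≤ u - u^2/2 + u^3/3 + |u|^4/(1-|u|) := by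
    nlinarith [h]
  have := mul_le_mul_of_nonneg_left hlog (by linarith : 0 ≤ 1 + u)
  have key : (1+u) * (u - u^2/2 + u^3/3) + 3/2*|u|^3 ≤ u + u^2/2 + 2 * |u| * u^2 := by
    have e : |u|^3 = |u| * u^2 := by rw [pow_succ', sq_abs]
    rw [e]
    have : -u/6 + u^2/3 ≤ |u|/2 := by
      rw [← sq_abs u]; nlinarith [neg_abs_le u, abs_nonneg u]
    nlinarith [mul_le_mul_of_nonneg_left this (sq_nonneg u)]
  nlinarith

theorem stmt6 (d : ℕ) (hd : 1 ≤ d) (k : Fin d → ℤ) (hk : k ≠ 0)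
    (ε : ℝ) (hε : 0 < ε) (hε' : ε ≤ 1 / 4) :
    (∫ x in Set.Icc (0 : Fin d → ℝ) 1,
        (1 + 2 * ε * Real.cos (2 * Real.pi * ∑ i, (k i : ℝ) * x i)) *
          Real.log (1 + 2 * ε * Real.cos (2 * Real.pi * ∑ i, (k i : ℝ) * x i))) ≤
      ε ^ 2 * (1 + 8 * ε) := by
  have hk2 : (fun i => 2 * k i) ≠ 0 := by
    obtain ⟨j, hj⟩ := Function.ne_iff.mp hk
    exact Function.ne_iff.mpr ⟨j, by simpa using hj⟩
  have c1 := aux_cos d k hk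
  have c2 := aux_cos d _ hk2
  have hpt : ∀ x : Fin d → ℝ,
      (1 + 2 * ε * Real.cos (2 * Real.pi * ∑ i, (k i : ℝ) * x i)) *
          Real.log (1 + 2 * ε * Real.cos (2 * Real.pi * ∑ i, (k i : ℝ) * x i)) ≤
      2 * ε * Real.cos (2 * Real.pi * ∑ i, (k i : ℝ) * x i) +
        (ε^2 * (1 + 8 * ε) * Real.cos (2 * Real.pi * ∑ i, ((2 * k i : ℤ) : ℝ) * x i)
          + ε^2 * (1 + 8 * ε)) := by
    intro x
    have e : 2 * Real.pi * ∑ i, ((2 * k i : ℤ) : ℝ) * x i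
        = 2 * (2 * Real.pi * ∑ i, (k i : ℝ) * x i) := by
      push_cast
      simp_rw [mul_assoc (2 : ℝ) (_ : ℝ) (_ : ℝ), ← Finset.mul_sum]
      ring
    rw [e, Real.cos_two_mul]
    generalize 2 * Real.pi * ∑ i, (k i : ℝ) * x i = t
    have a1 := Real.neg_one_le_cos t
    have a2 := Real.cos_le_one t
    have := aux_log (2 * ε * Real.cos t) (by nlinarith) (by nlinarith)
    have ha : |2 * ε * Real.cos t| ≤ 2 * ε := by
      rw [abs_le]; constructor <;> nlinarith
    nlinarith [mul_le_mul_of_nonneg_right ha (sq_nonneg (2 * ε * Real.cos t))]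
  have hpos : ∀ x : Fin d → ℝ, 1 + 2 * ε * Real.cos (2 * Real.pi * ∑ i, (k i : ℝ) * x i) ≠ 0 := by
    intro x
    have a1 := Real.neg_one_le_cos (2 * Real.pi * ∑ i, (k i : ℝ) * x i)
    nlinarith
  have I : ∀ f : (Fin d → ℝ) → ℝ, Continuous f → IntegrableOn f (Set.Icc 0 1) := fun f hf =>
    hf.continuousOn.integrableOn_compact isCompact_Icc
  refine (integral_mono (I _ ?_) (I _ (by fun_prop)) hpt).trans ?_
  · exact Continuous.mul (by fun_prop) (Continuous.log (by fun_prop) hpos)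
  · rw [integral_add (I _ (by fun_prop)) (I _ (by fun_prop)),
      integral_add (I _ (by fun_prop)) (I _ (by fun_prop)),
      integral_const_mul, integral_const_mul, c1, c2]
    simp [Measure.real, Real.volume_Icc_pi]
end

section
/- Let d ≥ 1 be an integer and let 1 ≤ q < 2, with additionally q ≤ d/(d−1) if d ≥ 3; set θ_q := 2(q−1)/(q·(1 − (1/q − 1/d))). There exists a constant K > 0, depending only on d and q, such that for every strictly positive continuously differentiable ℤ^d-periodic probability density f on the torus, ‖∇f‖_{L^q(T^d)} ≤ K·( I(f)^{1/(2−θ_q)} · ‖f−1‖_{L¹(T^d)}^{(1−θ_q)/(2−θ_q)} + I(f)^{1/2} ), where I(f) := ∫_{T^d} |∇f|²/f dx is the Fisher information. -/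
open MeasureTheory

/-- The unit cube `[0,1)^d`, a fundamental domain of the torus `T^d = ℝ^d/ℤ^d`. -/
def unitCube (d : ℕ) : Set (EuclideanSpace ℝ (Fin d)) :=
  {x | ∀ i, x i ∈ Set.Ico (0 : ℝ) 1}

/-- The lattice vector of `ℝ^d` associated to `m ∈ ℤ^d`. -/
noncomputable def latVec (d : ℕ) (m : Fin d → ℤ) : EuclideanSpace ℝ (Fin d) :=
  (WithLp.equiv 2 (Fin d → ℝ)).symm fun i => (m i : ℝ)

open Real Set

lemma uc_subset (d : ℕ) : unitCube d ⊆ Metric.closedBall (0 : EuclideanSpace ℝ (Fin d)) (d + 1) := by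
  intro x hx
  rw [mem_closedBall_zero_iff, EuclideanSpace.norm_eq]
  have h1 : ∑ i, ‖x i‖ ^ 2 ≤ ∑ _i : Fin d, (1 : ℝ) := by
    refine Finset.sum_le_sum fun i _ => ?_
    have := hx i
    rw [Real.norm_eq_abs, abs_of_nonneg this.1]
    nlinarith [this.1, this.2]
  simp at h1
  refine Real.sqrt_le_iff.2 ⟨by positivity, ?_⟩
  simp
  nlinarith [(Nat.cast_nonneg d : (0 : ℝ) ≤ d)]

lemma uc_preimage (d : ℕ) : (WithLp.toLp 2 : (Fin d → ℝ) → EuclideanSpace ℝ (Fin d)) ⁻¹' unitCube d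
    = Set.pi Set.univ fun _ => Set.Ico (0 : ℝ) 1 := by
  ext x; simp [unitCube]

lemma uc_meas (d : ℕ) : MeasurableSet (unitCube d) := by
  have : unitCube d = ⋂ i, (fun x : EuclideanSpace ℝ (Fin d) => x i) ⁻¹' (Set.Ico (0 : ℝ) 1) := by
    ext x; simp [unitCube]
  rw [this]
  refine MeasurableSet.iInter fun i => ?_
  exact measurableSet_Ico.preimage (by fun_prop)

lemma uc_vol (d : ℕ) : volume (unitCube d) = 1 := by
  rw [← (PiLp.volume_preserving_toLp (Fin d)).measure_preimage (uc_meas d).nullMeasurableSet,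
    uc_preimage, Real.volume_pi_Ico]
  simp

instance uc_prob (d : ℕ) : IsProbabilityMeasure (volume.restrict (unitCube d)) :=
  ⟨by rw [Measure.restrict_apply_univ, uc_vol]⟩

lemma uc_int {d : ℕ} {F : Type*} [NormedAddCommGroup F] {u : EuclideanSpace ℝ (Fin d) → F}
    (hu : Continuous u) :
    Integrable u (volume.restrict (unitCube d)) := by
  have : IntegrableOn u (Metric.closedBall 0 (d + 1)) volume :=
    hu.continuousOn.integrableOn_compact (isCompact_closedBall _ _)
  exact this.mono_set (uc_subset d)

lemma uc_memLp {d : ℕ} {F : Type*} [NormedAddCommGroup F] {u : EuclideanSpace ℝ (Fin d) → F}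
    (hu : Continuous u) (p : ENNReal) :
    MemLp u p (volume.restrict (unitCube d)) := by
  obtain ⟨B, hB⟩ := (isCompact_closedBall (0 : EuclideanSpace ℝ (Fin d)) (d + 1)).exists_bound_of_continuousOn hu.continuousOn
  refine MemLp.of_bound (uc_int hu).aestronglyMeasurable B ?_
  filter_upwards [ae_restrict_mem (uc_meas d)] with x hx
  exact hB x (uc_subset d hx)

/-- Hölder in the form used below. -/
lemma uc_holder {d : ℕ} {u v : EuclideanSpace ℝ (Fin d) → ℝ} (hu : Continuous u) (hv : Continuous v)
    (hu0 : ∀ x, 0 ≤ u x) (hv0 : ∀ x, 0 ≤ v x) {α β : ℝ} (hα : 0 < α) (hβ : 0 < β) (hab : α + β = 1) :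
    ∫ x in unitCube d, u x ^ α * v x ^ β ≤
      (∫ x in unitCube d, u x) ^ α * (∫ x in unitCube d, v x) ^ β := by
  have hc : (α⁻¹).HolderConjugate (β⁻¹) := by
    rw [Real.holderConjugate_iff]
    refine ⟨(one_lt_inv₀ hα).2 (by linarith), by simpa using hab⟩
  have h := integral_mul_le_Lp_mul_Lq_of_nonneg (μ := volume.restrict (unitCube d)) hc
    (f := fun x => u x ^ α) (g := fun x => v x ^ β)
    (Filter.Eventually.of_forall fun x => Real.rpow_nonneg (hu0 x) _)
    (Filter.Eventually.of_forall fun x => Real.rpow_nonneg (hv0 x) _)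
    (uc_memLp (hu.rpow_const fun _ => Or.inr hα.le) _)
    (uc_memLp (hv.rpow_const fun _ => Or.inr hβ.le) _)
  have e1 : ∀ x, (u x ^ α) ^ α⁻¹ = u x := fun x => Real.rpow_rpow_inv (hu0 x) hα.ne'
  have e2 : ∀ x, (v x ^ β) ^ β⁻¹ = v x := fun x => Real.rpow_rpow_inv (hv0 x) hβ.ne'
  simpa [e1, e2] using h

/-- interpolation: `L^r` between `L^1` and `L^p`. -/
lemma uc_interp {d : ℕ} {g : EuclideanSpace ℝ (Fin d) → ℝ} (hg : Continuous g) {r p t : ℝ}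
    (hr : 1 < r) (hp : 0 < p) (ht0 : 0 ≤ t) (ht1 : t ≤ 1) (ht : 1 / r = t / p + (1 - t)) :
    (∫ x in unitCube d, |g x| ^ r) ^ (1 / r) ≤
      ((∫ x in unitCube d, |g x| ^ p) ^ (1 / p)) ^ t * (∫ x in unitCube d, |g x|) ^ (1 - t) := by
  have hr0 : 0 < r := by linarith
  have hA : 0 ≤ ∫ x in unitCube d, |g x| ^ p := integral_nonneg fun x => by positivity
  have hB : 0 ≤ ∫ x in unitCube d, |g x| := integral_nonneg fun x => by positivity
  rcases eq_or_lt_of_le ht1 with h1 | h1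
  · subst h1
    have : r = p := by
      have : 1 / r = 1 / p := by linarith
      field_simp at this; linarith
    subst this; simp
  rcases eq_or_lt_of_le ht0 with h0 | h0
  · subst h0
    have : 1 / r < 1 := by rw [div_lt_one hr0]; exact hr
    simp at ht this
    linarith
  have key := uc_holder (d := d) (u := fun x => |g x| ^ p) (v := fun x => |g x|)
    (hg.abs.rpow_const fun _ => Or.inr hp.le) hg.abs (fun x => by positivity) (fun x => by positivity)
    (α := t * r / p) (β := (1 - t) * r) (by positivity) (by nlinarith) (by
      have : r * (1 / r) = r * (t / p + (1 - t)) := by rw [ht]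
      rw [mul_one_div_cancel hr0.ne'] at this
      linear_combination -this)
  have e : ∀ x, (|g x| ^ p) ^ (t * r / p) * |g x| ^ ((1 - t) * r) = |g x| ^ r := by
    intro x
    rw [← Real.rpow_mul (abs_nonneg _), ← Real.rpow_add_of_nonneg (abs_nonneg _) (by positivity) (by nlinarith)]
    congr 1; field_simp; ring
  simp only [e] at key
  calc (∫ x in unitCube d, |g x| ^ r) ^ (1 / r) ≤ _ :=
        Real.rpow_le_rpow (integral_nonneg fun x => by positivity) key (by positivity)
    _ = _ := by
        rw [Real.mul_rpow (by positivity) (by positivity), ← Real.rpow_mul hA, ← Real.rpow_mul hA,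
          ← Real.rpow_mul hB]
        congr 2 <;> field_simp

lemma two_term_rpow {a b t : ℝ} (ha : 0 ≤ a) (hb : 0 ≤ b) (h0 : 0 ≤ t) (h1 : t ≤ 1) :
    (a + b) ^ t ≤ a ^ t + b ^ t := by
  lift a to NNReal using ha
  lift b to NNReal using hb
  exact_mod_cast NNReal.rpow_add_le_add_rpow a b h0 h1

/-- absorption via weighted AM-GM -/
lemma absorb {X A B t : ℝ} (hX : 0 ≤ X) (hB : 0 ≤ B) (h0 : 0 ≤ t) (h1 : t < 1)
    (h : X ≤ A + B * X ^ t) : X ≤ A / (1 - t) + B ^ (1 / (1 - t)) := by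
  have h2 : 0 < 1 - t := by linarith
  have := Real.geom_mean_le_arith_mean2_weighted h0 h2.le hX
    (Real.rpow_nonneg hB (1 / (1 - t))) (by ring)
  rw [← Real.rpow_mul hB, one_div_mul_cancel h2.ne', Real.rpow_one] at this
  have h3 : (1 - t) * X ≤ A + (1 - t) * B ^ (1 / (1 - t)) := by linarith
  have : X ≤ (A + (1 - t) * B ^ (1 / (1 - t))) / (1 - t) := by
    rw [le_div_iff₀ h2]; linarith
  calc X ≤ _ := this
    _ = _ := by field_simp

lemma latVec_apply {d : ℕ} (m : Fin d → ℤ) (i : Fin d) : latVec d m i = m i := rfl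

lemma per_fderiv {d : ℕ} {g : EuclideanSpace ℝ (Fin d) → ℝ}
    (hp : ∀ x m, g (x + latVec d m) = g x) (x : EuclideanSpace ℝ (Fin d)) (m : Fin d → ℤ) :
    fderiv ℝ g (x + latVec d m) = fderiv ℝ g x := by
  rw [← fderiv_comp_add_right]
  congr 1
  ext y; exact hp y m

lemma per_lint (d : ℕ) (R : ℝ) : ∃ N : ℕ, ∀ h : EuclideanSpace ℝ (Fin d) → ENNReal,
    (∀ x m, h (x + latVec d m) = h x) →
    ∫⁻ x in Metric.closedBall 0 R, h x ≤ N * ∫⁻ x in unitCube d, h x := by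
  obtain ⟨M, hM⟩ := exists_nat_ge R
  let S : Finset (Fin d → ℤ) := Fintype.piFinset fun _ => Finset.Icc (-(M : ℤ) - 1) (M + 1)
  refine ⟨S.card, fun h hh => ?_⟩
  have hT : ∀ m : Fin d → ℤ,
      ∫⁻ x in (fun x => x - latVec d m) ⁻¹' unitCube d, h x = ∫⁻ x in unitCube d, h x := by
    intro m
    have := (measurePreserving_sub_right (volume : Measure (EuclideanSpace ℝ (Fin d)))
      (latVec d m)).setLIntegral_comp_preimage_emb
      (MeasurableEquiv.subRight (latVec d m)).measurableEmbedding h (unitCube d)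
    rw [← this]
    congr 1; ext x
    rw [← hh (x - latVec d m) m, sub_add_cancel]
  have hsub : Metric.closedBall (0 : EuclideanSpace ℝ (Fin d)) R ⊆
      ⋃ m : S, (fun x => x - latVec d m) ⁻¹' unitCube d := by
    intro x hx
    rw [mem_closedBall_zero_iff] at hx
    have hb : ∀ i, |x i| ≤ M := fun i =>
      (by simpa using (PiLp.norm_apply_le x i).trans (hx.trans hM))
    refine mem_iUnion.2 ⟨⟨fun i => ⌊x i⌋, ?_⟩, ?_⟩
    · simp only [S, Fintype.mem_piFinset, Finset.mem_Icc]
      intro i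
      have := abs_le.1 (hb i)
      constructor
      · rw [Int.le_floor]; push_cast; linarith
      · rw [Int.floor_le_iff]; push_cast; linarith
    · intro i
      simp only [PiLp.sub_apply, latVec_apply]
      exact ⟨sub_nonneg.2 (Int.floor_le _), by linarith [Int.lt_floor_add_one (x i)]⟩
  calc ∫⁻ x in Metric.closedBall 0 R, h x
      ≤ ∫⁻ x in ⋃ m : S, (fun x => x - latVec d m) ⁻¹' unitCube d, h x := lintegral_mono_set hsub
    _ ≤ ∑' m : S, ∫⁻ x in (fun x => x - latVec d m) ⁻¹' unitCube d, h x := lintegral_iUnion_le _ _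
    _ = _ := by simp [hT, tsum_fintype]

lemma sob_en (d : ℕ) (hd : 1 ≤ d) (q p : NNReal) (hq : 1 ≤ q)
    (hp : (p : ℝ)⁻¹ = (q : ℝ)⁻¹ - (d : ℝ)⁻¹) :
    ∃ C : NNReal, ∀ g : EuclideanSpace ℝ (Fin d) → ℝ, ContDiff ℝ 1 g →
      (∀ x m, g (x + latVec d m) = g x) →
      eLpNorm g p (volume.restrict (unitCube d)) ≤
        C * (eLpNorm g q (volume.restrict (unitCube d)) +
          eLpNorm (fderiv ℝ g) q (volume.restrict (unitCube d))) := by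
  let χ : ContDiffBump (0 : EuclideanSpace ℝ (Fin d)) := ⟨d + 1, d + 2, by positivity, by linarith⟩
  have hχc : ContDiff ℝ 1 χ := χ.contDiff
  obtain ⟨A, hA⟩ := (hχc.continuous_fderiv one_ne_zero).bounded_above_of_compact_support
    (χ.hasCompactSupport.fderiv (𝕜 := ℝ))
  obtain ⟨N, hN⟩ := per_lint d (d + 2)
  let A' : NNReal := Real.toNNReal A + 1
  let C0 : NNReal := SNormLESNormFDerivOfEqConst ℝ (volume : Measure (EuclideanSpace ℝ (Fin d))) q
  have hq0 : (0 : ℝ) < q := lt_of_lt_of_le one_pos hq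
  have hq0' : (q : ENNReal) ≠ 0 := by
    exact_mod_cast (NNReal.coe_pos.1 hq0).ne'
  refine ⟨C0 * (A' * (N : NNReal) ^ (1 / (q : ℝ))), fun g hg hper => ?_⟩
  have hgd : Differentiable ℝ g := hg.differentiable one_ne_zero
  have hχd : Differentiable ℝ χ := hχc.differentiable one_ne_zero
  set u : EuclideanSpace ℝ (Fin d) → ℝ := fun x => χ x * g x with hu
  have h1 := eLpNorm_le_eLpNorm_fderiv_of_eq (F := ℝ)
    (volume : Measure (EuclideanSpace ℝ (Fin d))) (u := u)
    (hχc.mul hg) (χ.hasCompactSupport.mul_right) hq (by simp; omega) (p' := p) (by simpa using hp)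
  set w : EuclideanSpace ℝ (Fin d) → ℝ := fun x => ‖g x‖ + ‖fderiv ℝ g x‖ with hw
  have hfd : ∀ x, ‖fderiv ℝ u x‖ ≤ A' * w x := by
    intro x
    have : fderiv ℝ u x = χ x • fderiv ℝ g x + g x • fderiv ℝ χ x :=
      fderiv_fun_mul (hχd x) (hgd x)
    rw [this]
    have hA1 : A ≤ Real.toNNReal A := Real.le_coe_toNNReal A
    have e1 : ‖χ x • fderiv ℝ g x‖ ≤ 1 * ‖fderiv ℝ g x‖ := by
      rw [norm_smul, Real.norm_of_nonneg χ.nonneg]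
      gcongr; exact χ.le_one
    have e2 : ‖g x • fderiv ℝ χ x‖ ≤ ‖g x‖ * Real.toNNReal A := by
      rw [norm_smul]; gcongr; exact (hA x).trans hA1
    have e3 := norm_add_le (χ x • fderiv ℝ g x) (g x • fderiv ℝ χ x)
    have : (A' : ℝ) = Real.toNNReal A + 1 := by simp [A']
    rw [this, hw]
    have := norm_nonneg (g x)
    have := norm_nonneg (fderiv ℝ g x)
    have : (0 : ℝ) ≤ Real.toNNReal A := NNReal.coe_nonneg _
    nlinarith
  have hfd0 : ∀ x, x ∉ Metric.closedBall (0 : EuclideanSpace ℝ (Fin d)) (d + 2) → fderiv ℝ u x = 0 := by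
    intro x hx
    by_contra hne
    have h2 : x ∈ tsupport u := support_fderiv_subset ℝ (Function.mem_support.2 hne)
    have h3 : tsupport u ⊆ tsupport χ := closure_mono (Function.support_mul_subset_left _ _)
    have := h3 h2
    rw [χ.tsupport_eq] at this
    exact hx this
  have h2 : eLpNorm g p (volume.restrict (unitCube d)) ≤ eLpNorm u p volume := by
    refine le_trans (le_of_eq ?_) (eLpNorm_mono_measure u (Measure.restrict_le_self (s := unitCube d)))
    refine eLpNorm_congr_ae ?_
    filter_upwards [ae_restrict_mem (uc_meas d)] with x hx
    have : χ x = 1 := χ.one_of_mem_closedBall (uc_subset d hx)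
    simp [hu, this]
  have h3 : eLpNorm (fderiv ℝ u) q volume ≤
      eLpNorm (fun x => (A' : ℝ) * w x) q (volume.restrict (Metric.closedBall 0 (d + 2))) := by
    rw [← eLpNorm_indicator_eq_eLpNorm_restrict Metric.isClosed_closedBall.measurableSet]
    refine eLpNorm_mono fun x => ?_
    by_cases hx : x ∈ Metric.closedBall (0 : EuclideanSpace ℝ (Fin d)) (d + 2)
    · rw [indicator_of_mem hx]; exact (hfd x).trans (le_abs_self _)
    · rw [hfd0 x hx]; simp
  have h4 : eLpNorm (fun x => (A' : ℝ) * w x) q (volume.restrict (Metric.closedBall 0 (d + 2))) ≤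
      A' * eLpNorm w q (volume.restrict (Metric.closedBall 0 (d + 2))) := by
    refine (eLpNorm_const_smul_le (c := (A' : ℝ)) (f := w)).trans (le_of_eq ?_)
    simp
  have h5 : eLpNorm w q (volume.restrict (Metric.closedBall 0 (d + 2))) ≤
      (N : ENNReal) ^ (1 / (q : ℝ)) * eLpNorm w q (volume.restrict (unitCube d)) := by
    rw [eLpNorm_eq_lintegral_rpow_enorm_toReal hq0' ENNReal.coe_ne_top,
      eLpNorm_eq_lintegral_rpow_enorm_toReal hq0' ENNReal.coe_ne_top, ENNReal.coe_toReal,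
      ← ENNReal.mul_rpow_of_nonneg _ _ (by positivity)]
    refine ENNReal.rpow_le_rpow (hN _ ?_) (by positivity)
    intro x m
    simp only [hw, hper, per_fderiv hper]
  have h6 : eLpNorm w q (volume.restrict (unitCube d)) ≤
      eLpNorm g q (volume.restrict (unitCube d)) +
          eLpNorm (fderiv ℝ g) q (volume.restrict (unitCube d)) := by
    refine (eLpNorm_add_le (hg.continuous.norm.aestronglyMeasurable)
      ((hg.continuous_fderiv one_ne_zero).norm.aestronglyMeasurable) (by exact_mod_cast hq)).trans ?_
    rw [eLpNorm_norm, eLpNorm_norm]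
  calc _ ≤ _ := h2
    _ ≤ _ := h1
    _ ≤ C0 * (A' * ((N : ENNReal) ^ (1 / (q : ℝ)) * (eLpNorm g q (volume.restrict (unitCube d)) +
          eLpNorm (fderiv ℝ g) q (volume.restrict (unitCube d))))) := by
        gcongr
        exact h3.trans (h4.trans (by gcongr; exact h5.trans (by gcongr)))
    _ = _ := by
        push_cast
        rw [ENNReal.coe_rpow_of_nonneg _ (by positivity)]
        push_cast
        ring

lemma uc_eLp {d : ℕ} {F : Type*} [NormedAddCommGroup F] {u : EuclideanSpace ℝ (Fin d) → F}
    (hu : Continuous u) {p : ℝ} (hp : 0 < p) :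
    eLpNorm u (Real.toNNReal p) (volume.restrict (unitCube d)) =
      ENNReal.ofReal ((∫ x in unitCube d, ‖u x‖ ^ p) ^ (1 / p)) := by
  rw [(uc_memLp hu _).eLpNorm_eq_integral_rpow_norm (by simpa using hp) ENNReal.coe_ne_top]
  simp [hp.le]

lemma sob_re (d : ℕ) (hd : 1 ≤ d) (q p : ℝ) (hq : 1 ≤ q) (hp0 : 0 < p)
    (hp : 1 / p = 1 / q - 1 / d) :
    ∃ C : ℝ, 0 ≤ C ∧ ∀ g : EuclideanSpace ℝ (Fin d) → ℝ, ContDiff ℝ 1 g →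
      (∀ x m, g (x + latVec d m) = g x) →
      (∫ x in unitCube d, |g x| ^ p) ^ (1 / p) ≤
        C * ((∫ x in unitCube d, |g x| ^ q) ^ (1 / q) +
          (∫ x in unitCube d, ‖fderiv ℝ g x‖ ^ q) ^ (1 / q)) := by
  have hq0 : 0 < q := by linarith
  obtain ⟨C, hC⟩ := sob_en d hd q.toNNReal p.toNNReal (by simpa using hq)
    (by rw [Real.coe_toNNReal _ hq0.le, Real.coe_toNNReal _ hp0.le]; simpa using hp)
  refine ⟨C, C.2, fun g hg hper => ?_⟩
  have := hC g hg hper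
  rw [uc_eLp hg.continuous hp0, uc_eLp hg.continuous hq0,
    uc_eLp (hg.continuous_fderiv one_ne_zero) hq0,
    ← ENNReal.ofReal_add (by positivity) (by positivity), ← ENNReal.ofReal_coe_nnreal,
    ← ENNReal.ofReal_mul (NNReal.coe_nonneg C), ENNReal.ofReal_le_ofReal_iff (by positivity)] at this
  exact this

lemma GN2 (d : ℕ) (hd : 1 ≤ d) (q p a θ : ℝ) (hq : 1 < q) (hqp : q < p)
    (hp : 1 / p = 1 / q - 1 / d) (ha : 1 < a) (h0 : 0 ≤ θ) (h1 : θ ≤ 1)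
    (hθ : 1 / a = θ / p + (1 - θ)) :
    ∃ C : ℝ, 0 ≤ C ∧ ∀ g : EuclideanSpace ℝ (Fin d) → ℝ, ContDiff ℝ 1 g →
      (∀ x m, g (x + latVec d m) = g x) →
      (∫ x in unitCube d, |g x| ^ a) ^ (1 / a) ≤
        C * (((∫ x in unitCube d, ‖fderiv ℝ g x‖ ^ q) ^ (1 / q)) ^ θ *
          (∫ x in unitCube d, |g x|) ^ (1 - θ) + ∫ x in unitCube d, |g x|) := by
  have hp0 : 0 < p := by linarith
  have hp1 : 1 < p := by linarith
  have hq0 : 0 < q := by linarith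
  obtain ⟨C, hC0, hC⟩ := sob_re d hd q p hq.le hp0 hp
  have hp2 : 0 < 1 - 1 / p := by
    rw [sub_pos, div_lt_one hp0]; exact hp1
  have hpq : 1 / p < 1 / q := one_div_lt_one_div_of_lt hq0 hqp
  have hq2 : 1 / q < 1 := by rw [div_lt_one hq0]; exact hq
  obtain ⟨t, ht⟩ : ∃ t, t = (1 - 1 / q) / (1 - 1 / p) := ⟨_, rfl⟩
  have ht0 : 0 ≤ t := by rw [ht]; exact div_nonneg (by linarith) hp2.le
  have ht1 : t < 1 := by rw [ht, div_lt_one hp2]; linarith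
  have htq : 1 / q = t / p + (1 - t) := by
    have : t * (1 - 1 / p) = 1 - 1 / q := by rw [ht, div_mul_cancel₀ _ hp2.ne']
    have e : t / p = t * (1 / p) := by ring
    rw [e]; linarith
  have h1t : 0 < 1 - t := by linarith
  obtain ⟨D, hD⟩ : ∃ D, D = C / (1 - t) + C ^ (1 / (1 - t)) := ⟨_, rfl⟩
  have hD0 : 0 ≤ D := by rw [hD]; positivity
  refine ⟨D ^ θ, by positivity, fun g hg hper => ?_⟩
  have hS := hC g hg hper
  have hI1 := uc_interp (d := d) hg.continuous hq hp0 ht0 ht1.le htq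
  have hI2 := uc_interp (d := d) hg.continuous ha hp0 h0 h1 hθ
  have hX0 : 0 ≤ (∫ x in unitCube d, ‖fderiv ℝ g x‖ ^ q) ^ (1 / q) :=
    Real.rpow_nonneg (integral_nonneg fun x => by positivity) _
  have hL0 : 0 ≤ (∫ x in unitCube d, |g x| ^ p) ^ (1 / p) :=
    Real.rpow_nonneg (integral_nonneg fun x => by positivity) _
  have hm0 : 0 ≤ ∫ x in unitCube d, |g x| := integral_nonneg fun x => by positivity
  generalize (∫ x in unitCube d, ‖fderiv ℝ g x‖ ^ q) ^ (1 / q) = X at *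
  generalize (∫ x in unitCube d, |g x| ^ p) ^ (1 / p) = L at *
  generalize (∫ x in unitCube d, |g x|) = m at *
  have hL : L ≤ D * (X + m) := by
    have e1 : L ≤ C * X + (C * m ^ (1 - t)) * L ^ t := by
      calc L ≤ _ := hS
        _ ≤ C * (L ^ t * m ^ (1 - t) + X) := by gcongr
        _ = _ := by ring
    have e2 := absorb hL0 (by positivity) ht0 ht1 e1
    rw [Real.mul_rpow hC0 (by positivity), ← Real.rpow_mul hm0, mul_one_div_cancel h1t.ne',
      Real.rpow_one] at e2
    refine e2.trans ?_
    rw [hD]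
    have : 0 ≤ C / (1 - t) * m := by positivity
    have : 0 ≤ C ^ (1 / (1 - t)) * X := by positivity
    have : C * X / (1 - t) = C / (1 - t) * X := by ring
    rw [this]
    nlinarith
  calc _ ≤ _ := hI2
    _ ≤ (D * (X + m)) ^ θ * m ^ (1 - θ) := by gcongr
    _ = D ^ θ * ((X + m) ^ θ * m ^ (1 - θ)) := by
        rw [Real.mul_rpow hD0 (by positivity)]; ring
    _ ≤ D ^ θ * ((X ^ θ + m ^ θ) * m ^ (1 - θ)) := by
        gcongr; exact two_term_rpow hX0 hm0 h0 h1
    _ = _ := by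
        rw [add_mul, ← Real.rpow_add_of_nonneg hm0 h0 (by linarith)]; simp

/-- one-dimensional pointwise estimate on the line -/
lemma line_est {φ : ℝ → ℝ} (hφ : ContDiff ℝ 1 φ) {s : ℝ} (hs : 1 < s) {x y : ℝ}
    (hx : x ∈ Ico (0 : ℝ) 1) (hy : y ∈ Ico (0 : ℝ) 1) :
    |φ x| ^ s ≤ |φ y| ^ s + s * ∫ t in Ico (0 : ℝ) 1, |φ t| ^ (s - 1) * |deriv φ t| := by
  have hd := hφ.differentiable one_ne_zero
  have hdc := hφ.continuous_deriv_one
  have hψ : ContDiff ℝ 1 (fun t => |φ t| ^ s) := by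
    exact (contDiff_norm_rpow (E := ℝ) hs).comp hφ
  have hder : ∀ t, |deriv (fun t => |φ t| ^ s) t| ≤ s * (|φ t| ^ (s - 1) * |deriv φ t|) := by
    intro t
    have h := ((hasDerivAt_abs_rpow (φ t) hs).comp t (hd t).hasDerivAt).deriv
    have e : deriv (fun t => |φ t| ^ s) t = s * |φ t| ^ (s - 2) * φ t * deriv φ t := h
    rw [e, abs_mul, abs_mul, abs_mul, abs_of_pos (by linarith : 0 < s),
      abs_of_nonneg (Real.rpow_nonneg (abs_nonneg (φ t)) _)]
    rcases eq_or_ne (φ t) 0 with h0 | h0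
    · simp [h0]
      positivity
    · have : |φ t| ^ (s - 1) = |φ t| ^ (s - 2) * |φ t| := by
        rw [← Real.rpow_add_one (by simpa using h0)]; congr 1; ring
      rw [this]; apply le_of_eq; ring
  have hftc : ∫ t in y..x, deriv (fun t => |φ t| ^ s) t = |φ x| ^ s - |φ y| ^ s :=
    intervalIntegral.integral_deriv_eq_sub (fun t _ => hψ.differentiable one_ne_zero t)
      (hψ.continuous_deriv_one.intervalIntegrable _ _)
  have hcont : Continuous fun t => s * (|φ t| ^ (s - 1) * |deriv φ t|) :=
    continuous_const.mul ((hφ.continuous.abs.rpow_const fun _ => Or.inr (by linarith)).mul hdc.abs)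
  have hsub : uIoc y x ⊆ Icc (0 : ℝ) 1 := by
    intro t ht
    rw [mem_uIoc] at ht
    rcases ht with h | h
    · exact ⟨by linarith [hy.1], by linarith [hx.2]⟩
    · exact ⟨by linarith [hx.1], by linarith [hy.2]⟩
  have h1 : ‖∫ t in y..x, deriv (fun t => |φ t| ^ s) t‖ ≤
      ∫ t in Icc (0 : ℝ) 1, s * (|φ t| ^ (s - 1) * |deriv φ t|) := by
    calc _ ≤ ∫ t in uIoc y x, ‖deriv (fun t => |φ t| ^ s) t‖ :=
          intervalIntegral.norm_integral_le_integral_norm_uIoc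
      _ ≤ ∫ t in uIoc y x, s * (|φ t| ^ (s - 1) * |deriv φ t|) := by
          refine setIntegral_mono ?_ ?_ hder
          · exact (hψ.continuous_deriv_one.abs.intervalIntegrable y x).def'
          · exact (hcont.intervalIntegrable y x).def'
      _ ≤ _ := by
          refine setIntegral_mono_set hcont.continuousOn.integrableOn_Icc ?_ hsub.eventuallyLE
          exact Filter.Eventually.of_forall fun t => by
            have : 0 < s := by linarith
            simp only [Pi.zero_apply]; positivity
  rw [hftc, Real.norm_eq_abs, integral_const_mul, integral_Icc_eq_integral_Ico] at h1
  linarith [le_abs_self (|φ x| ^ s - |φ y| ^ s)]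

lemma GN1_pt {g : EuclideanSpace ℝ (Fin 1) → ℝ} (hg : ContDiff ℝ 1 g) {s : ℝ} (hs : 1 < s)
    {x y : EuclideanSpace ℝ (Fin 1)} (hx : x ∈ unitCube 1) (hy : y ∈ unitCube 1) :
    |g x| ^ s ≤ |g y| ^ s + s * ∫ z in unitCube 1, |g z| ^ (s - 1) * ‖fderiv ℝ g z‖ := by
  let e : ℝ ≃ₗᵢ[ℝ] EuclideanSpace ℝ (Fin 1) := (OrthonormalBasis.singleton (Fin 1) ℝ).repr
  have he : ∀ t i, e t i = t := by
    intro t i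
    exact ((OrthonormalBasis.singleton (Fin 1) ℝ).repr_apply_apply t i).trans (by simp)
  have hpre : e ⁻¹' unitCube 1 = Ico (0 : ℝ) 1 := by
    ext t; simp [unitCube, he]
  have hs' : ∀ z, z ∈ unitCube 1 → e.symm z ∈ Ico (0 : ℝ) 1 := by
    intro z hz; rw [← hpre]; simpa using hz
  have hφ : ContDiff ℝ 1 (g ∘ e) := hg.comp e.contDiff
  have h := line_est hφ hs (hs' x hx) (hs' y hy)
  simp only [Function.comp, LinearIsometryEquiv.apply_symm_apply] at h
  have hmp := e.measurePreserving.setIntegral_preimage_emb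
    e.toHomeomorph.measurableEmbedding (fun z => |g z| ^ (s - 1) * ‖fderiv ℝ g z‖) (unitCube 1)
  rw [hpre] at hmp
  have hs0 : 0 < s := by linarith
  have hle : ∫ t in Ico (0 : ℝ) 1, |g (e t)| ^ (s - 1) * |deriv (fun t => g (e t)) t| ≤
      ∫ t in Ico (0 : ℝ) 1, |g (e t)| ^ (s - 1) * ‖fderiv ℝ g (e t)‖ := by
    have hc1 : Continuous fun t => |g (e t)| ^ (s - 1) :=
      ((hg.continuous.comp e.continuous).abs.rpow_const fun _ => Or.inr (by linarith))
    refine setIntegral_mono_on ?_ ?_ measurableSet_Ico ?_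
    · exact ((hc1.mul hφ.continuous_deriv_one.abs).continuousOn.integrableOn_Icc).mono_set Ico_subset_Icc_self
    · exact ((hc1.mul ((hg.continuous_fderiv one_ne_zero).comp e.continuous).norm).continuousOn.integrableOn_Icc).mono_set Ico_subset_Icc_self
    · intro t _
      have hd : HasDerivAt (fun t => g (e t)) (fderiv ℝ g (e t) (e 1)) t := by
        have h1 := (hg.differentiable one_ne_zero (e t)).hasFDerivAt
        have h2 : HasDerivAt e (e 1) t := by
          have := (e.toContinuousLinearEquiv : ℝ →L[ℝ] EuclideanSpace ℝ (Fin 1)).hasDerivAt (x := t)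
          exact this
        exact h1.comp_hasDerivAt t h2
      rw [hd.deriv]
      have : |fderiv ℝ g (e t) (e 1)| ≤ ‖fderiv ℝ g (e t)‖ := by
        have := (fderiv ℝ g (e t)).le_opNorm (e 1)
        simpa using this
      gcongr
  rw [hmp] at hle
  calc _ ≤ _ := h
    _ ≤ _ := by gcongr; exact hle

lemma GN1 (q : ℝ) (hq : 1 < q) (hq2 : q < 2) :
    ∃ C : ℝ, 0 ≤ C ∧ ∀ g : EuclideanSpace ℝ (Fin 1) → ℝ, ContDiff ℝ 1 g →
      (∫ x in unitCube 1, |g x| ^ (q / (2 - q))) ^ (1 / (q / (2 - q))) ≤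
        C * (((∫ x in unitCube 1, ‖fderiv ℝ g x‖ ^ q) ^ (1 / q)) ^ (2 * (q - 1) / (2 * q - 1)) *
          (∫ x in unitCube 1, |g x|) ^ (1 - (2 * (q - 1) / (2 * q - 1))) +
            ∫ x in unitCube 1, |g x|) := by
  obtain ⟨s, hsd⟩ : ∃ s, s = (2 * q - 1) / q := ⟨_, rfl⟩
  obtain ⟨θ, hθd⟩ : ∃ θ, θ = 2 * (q - 1) / (2 * q - 1) := ⟨_, rfl⟩
  obtain ⟨a, had⟩ : ∃ a, a = q / (2 - q) := ⟨_, rfl⟩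
  rw [← hθd, ← had]
  have h2q : 0 < 2 - q := by linarith
  have hq0 : 0 < q := by linarith
  have h2q1 : 0 < 2 * q - 1 := by linarith
  have hs : 1 < s := by rw [hsd, lt_div_iff₀ hq0]; linarith
  have hs0 : 0 < s := by linarith
  have h0 : 0 ≤ θ := by rw [hθd]; exact div_nonneg (by linarith) h2q1.le
  have h1 : θ ≤ 1 := by rw [hθd, div_le_one h2q1]; linarith
  have ha : 1 < a := by rw [had, lt_div_iff₀ h2q]; linarith
  have ha0 : 0 < a := by linarith
  have hsθ : s * θ = 1 - 1 / a := by rw [hsd, hθd, had]; field_simp; ring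
  refine ⟨1 + s ^ θ, by positivity, fun g hg => ?_⟩
  have hX0 : 0 ≤ (∫ x in unitCube 1, ‖fderiv ℝ g x‖ ^ q) ^ (1 / q) :=
    Real.rpow_nonneg (integral_nonneg fun x => by positivity) _
  have hm0 : 0 ≤ ∫ x in unitCube 1, |g x| := integral_nonneg fun x => by positivity
  have hgi := uc_int hg.continuous.abs
  obtain ⟨y, hy, hym⟩ : ∃ y ∈ unitCube 1, |g y| ≤ ∫ x in unitCube 1, |g x| := by
    have := exists_le_setAverage (μ := volume) (s := unitCube 1) (f := fun x => |g x|)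
      (by rw [uc_vol]; simp) (by rw [uc_vol]; simp) hgi
    rw [setAverage_eq] at this
    simpa [measureReal_def, uc_vol] using this
  have hH : ∫ z in unitCube 1, |g z| ^ (s - 1) * ‖fderiv ℝ g z‖ ≤
      (∫ x in unitCube 1, |g x|) ^ (s - 1) * (∫ x in unitCube 1, ‖fderiv ℝ g x‖ ^ q) ^ (1 / q) := by
    have := uc_holder (d := 1) (u := fun x => |g x|) (v := fun x => ‖fderiv ℝ g x‖ ^ q)
      hg.continuous.abs ((hg.continuous_fderiv one_ne_zero).norm.rpow_const fun _ => Or.inr hq0.le)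
      (fun x => by positivity) (fun x => by positivity) (α := s - 1) (β := 1 / q)
      (by linarith) (by positivity) (by rw [hsd]; field_simp; ring)
    have e : ∀ x, (‖fderiv ℝ g x‖ ^ q) ^ (1 / q) = ‖fderiv ℝ g x‖ := fun x => by
      rw [one_div, Real.rpow_rpow_inv (norm_nonneg _) hq0.ne']
    simpa only [e] using this
  generalize (∫ x in unitCube 1, ‖fderiv ℝ g x‖ ^ q) ^ (1 / q) = X at *
  obtain ⟨m, hm⟩ : ∃ m, m = ∫ x in unitCube 1, |g x| := ⟨_, rfl⟩
  rw [← hm] at hm0 hym hH ⊢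
  obtain ⟨W, hW⟩ : ∃ W, W = m ^ s + s * (m ^ (s - 1) * X) := ⟨_, rfl⟩
  have hW0 : 0 ≤ W := by rw [hW]; positivity
  have hpt : ∀ x ∈ unitCube 1, |g x| ^ s ≤ W := by
    intro x hx
    calc _ ≤ _ := GN1_pt hg hs hx hy
      _ ≤ _ := by rw [hW]; gcongr
  have hpt2 : ∀ x ∈ unitCube 1, |g x| ^ a ≤ W ^ ((a - 1) / s) * |g x| := by
    intro x hx
    have e : |g x| ^ a = (|g x| ^ s) ^ ((a - 1) / s) * |g x| := by
      rw [← Real.rpow_mul (abs_nonneg _), mul_div_cancel₀ _ hs0.ne']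
      nth_rw 3 [← Real.rpow_one |g x|]
      rw [← Real.rpow_add_of_nonneg (abs_nonneg _) (by linarith) (by linarith)]
      congr 1; ring
    rw [e]
    have : 0 ≤ (a - 1) / s := div_nonneg (by linarith) hs0.le
    gcongr
    exact hpt x hx
  have hint : ∫ x in unitCube 1, |g x| ^ a ≤ W ^ ((a - 1) / s) * m := by
    rw [hm, ← integral_const_mul]
    exact setIntegral_mono_on (uc_int (hg.continuous.abs.rpow_const fun _ => Or.inr ha0.le))
      (hgi.const_mul _) (uc_meas 1) hpt2
  calc (∫ x in unitCube 1, |g x| ^ a) ^ (1 / a) ≤ (W ^ ((a - 1) / s) * m) ^ (1 / a) :=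
        Real.rpow_le_rpow (integral_nonneg fun x => by positivity) hint (by positivity)
    _ = W ^ θ * m ^ (1 / a) := by
        rw [Real.mul_rpow (by positivity) hm0, ← Real.rpow_mul hW0]
        congr 2
        rw [eq_comm, ← mul_right_inj' hs0.ne', hsθ]; field_simp
    _ ≤ ((m ^ s) ^ θ + (s * (m ^ (s - 1) * X)) ^ θ) * m ^ (1 / a) := by
        gcongr
        rw [hW]
        exact two_term_rpow (by positivity) (by positivity) h0 h1
    _ = m + s ^ θ * (X ^ θ * m ^ (1 - θ)) := by
        have hs1 : 0 ≤ s - 1 := by linarith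
        rw [Real.mul_rpow hs0.le (by positivity), Real.mul_rpow (by positivity) hX0,
          ← Real.rpow_mul hm0, ← Real.rpow_mul hm0, add_mul,
          ← Real.rpow_add_of_nonneg hm0 (by positivity) (by positivity)]
        have e1 : s * θ + 1 / a = 1 := by rw [hsθ]; ring
        have e2 : m ^ (1 - θ) = m ^ ((s - 1) * θ) * m ^ (1 / a) := by
          rw [← Real.rpow_add_of_nonneg hm0 (by positivity) (by positivity)]
          congr 1; linarith
        rw [e1, e2, Real.rpow_one]; ring
    _ ≤ _ := by
        have : 0 ≤ s ^ θ := by positivity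
        have : 0 ≤ X ^ θ * m ^ (1 - θ) := by positivity
        nlinarith

lemma theta_facts (d : ℕ) (hd : 1 ≤ d) (q : ℝ) (hq1 : 1 ≤ q) (hq2 : q < 2)
    (hq3 : 3 ≤ d → q ≤ (d : ℝ) / ((d : ℝ) - 1)) :
    0 ≤ 2 * (q - 1) / (q * (1 - (1 / q - 1 / (d : ℝ)))) ∧
    2 * (q - 1) / (q * (1 - (1 / q - 1 / (d : ℝ)))) ≤ 1 ∧ 0 < 1 - (1 / q - 1 / (d : ℝ)) := by
  have hq0 : 0 < q := by linarith
  have hd0 : (0 : ℝ) < d := by exact_mod_cast hd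
  have hqi : 1 / q ≤ 1 := by rw [div_le_one hq0]; exact hq1
  have hdi : 0 < 1 / (d : ℝ) := by positivity
  have hpos : 0 < 1 - (1 / q - 1 / (d : ℝ)) := by linarith
  refine ⟨div_nonneg (by linarith) (by positivity), ?_, hpos⟩
  rw [div_le_one (by positivity)]
  have e : q * (1 - (1 / q - 1 / (d : ℝ))) = q - 1 + q / d := by field_simp; ring
  rw [e]
  have key : q - 1 ≤ q / d := by
    rw [le_div_iff₀ hd0]
    rcases (by omega : d = 1 ∨ d = 2 ∨ 3 ≤ d) with h | h | h
    · subst h; simp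
    · subst h; push_cast; linarith
    · have h3 : (3 : ℝ) ≤ d := by exact_mod_cast h
      have := hq3 h
      rw [le_div_iff₀ (by linarith)] at this
      linarith
  linarith

lemma GN (d : ℕ) (hd : 1 ≤ d) (q : ℝ) (hq1 : 1 ≤ q) (hq2 : q < 2)
    (hq3 : 3 ≤ d → q ≤ (d : ℝ) / ((d : ℝ) - 1)) (θ : ℝ)
    (hθ : θ = 2 * (q - 1) / (q * (1 - (1 / q - 1 / (d : ℝ))))) :
    ∃ C : ℝ, 0 ≤ C ∧ ∀ g : EuclideanSpace ℝ (Fin d) → ℝ, ContDiff ℝ 1 g →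
      (∀ x m, g (x + latVec d m) = g x) →
      (∫ x in unitCube d, |g x| ^ (q / (2 - q))) ^ (1 / (q / (2 - q))) ≤
        C * (((∫ x in unitCube d, ‖fderiv ℝ g x‖ ^ q) ^ (1 / q)) ^ θ *
          (∫ x in unitCube d, |g x|) ^ (1 - θ) + ∫ x in unitCube d, |g x|) := by
  have hq0 : 0 < q := by linarith
  have h2q : 0 < 2 - q := by linarith
  have hd0 : (0 : ℝ) < d := by exact_mod_cast hd
  obtain ⟨t0, t1, t2⟩ := theta_facts d hd q hq1 hq2 hq3
  rcases eq_or_lt_of_le hq1 with h | h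
  · subst h
    have hθ0 : θ = 0 := by rw [hθ]; simp
    refine ⟨1, zero_le_one, fun g hg hper => ?_⟩
    have e : (1 : ℝ) / (2 - 1) = 1 := by norm_num
    have hm0 : 0 ≤ ∫ x in unitCube d, |g x| := integral_nonneg fun x => by positivity
    simp only [hθ0, e, Real.rpow_one, Real.rpow_zero, div_one, sub_zero]
    linarith
  rcases eq_or_lt_of_le hd with h1 | h1
  · subst h1
    obtain ⟨C, hC0, hC⟩ := GN1 q h hq2
    have : θ = 2 * (q - 1) / (2 * q - 1) := by
      rw [hθ]; congr 1; push_cast; field_simp; ring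
    rw [← this] at hC
    exact ⟨C, hC0, fun g hg _ => hC g hg⟩
  have hd2 : (2 : ℝ) ≤ d := by exact_mod_cast h1
  have hqd : q < d := by linarith
  have hr : 1 / (d : ℝ) < 1 / q := one_div_lt_one_div_of_lt hq0 hqd
  have hpos : 0 < 1 / q - 1 / (d : ℝ) := by linarith
  refine GN2 d hd q (1 / (1 / q - 1 / (d : ℝ))) (q / (2 - q)) θ h ?_ (by rw [one_div_one_div]) ?_
    (by rw [hθ]; exact t0) (by rw [hθ]; exact t1) ?_
  · rw [lt_one_div hq0 hpos]
    have : 0 < 1 / (d : ℝ) := by positivity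
    linarith
  · rw [lt_div_iff₀ h2q]; linarith
  · have e : θ * (1 - (1 / q - 1 / (d : ℝ))) = 2 * (q - 1) / q := by
      rw [hθ]
      generalize 1 - (1 / q - 1 / (d : ℝ)) = z at *
      field_simp
    have e2 : θ / (1 / (1 / q - 1 / (d : ℝ))) = θ * (1 / q - 1 / (d : ℝ)) := by
      rw [div_div_eq_mul_div, div_one]
    have e3 : 1 / (q / (2 - q)) = 1 - 2 * (q - 1) / q := by field_simp; ring
    rw [e2, e3, ← e]; ring

set_option maxHeartbeats 2000000 in
theorem stmt11 (d : ℕ) (hd : 1 ≤ d) (q : ℝ) (hq1 : 1 ≤ q) (hq2 : q < 2)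
    (hq3 : 3 ≤ d → q ≤ (d : ℝ) / ((d : ℝ) - 1)) :
    let θ : ℝ := 2 * (q - 1) / (q * (1 - (1 / q - 1 / (d : ℝ))))
    ∃ K : ℝ, 0 < K ∧
      ∀ f : EuclideanSpace ℝ (Fin d) → ℝ,
        ContDiff ℝ 1 f → (∀ x, 0 < f x) →
        (∀ x m, f (x + latVec d m) = f x) →
        (∫ x in unitCube d, f x) = 1 →
        (∫ x in unitCube d, ‖fderiv ℝ f x‖ ^ q) ^ (1 / q) ≤
          K * ((∫ x in unitCube d, ‖fderiv ℝ f x‖ ^ 2 / f x) ^ (1 / (2 - θ)) *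
                (∫ x in unitCube d, |f x - 1|) ^ ((1 - θ) / (2 - θ)) +
              (∫ x in unitCube d, ‖fderiv ℝ f x‖ ^ 2 / f x) ^ ((1 : ℝ) / 2)) := by

  intro θ
  obtain ⟨t0, t1, t2⟩ := theta_facts d hd q hq1 hq2 hq3
  have hθ0 : 0 ≤ θ := t0
  have hθ1 : θ ≤ 1 := t1
  obtain ⟨C, hC0, hC⟩ := GN d hd q hq1 hq2 hq3 θ rfl
  have hq0 : 0 < q := by linarith
  have h2q : 0 < 2 - q := by linarith
  have h2θ : 0 < 2 - θ := by linarith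
  obtain ⟨a, had⟩ : ∃ a, a = q / (2 - q) := ⟨_, rfl⟩
  have ha0 : 0 < a := by rw [had]; positivity
  have ha1 : 1 ≤ a := by rw [had, le_div_iff₀ h2q]; linarith
  rw [← had] at hC
  obtain ⟨B, hB⟩ : ∃ B : ℝ, B = 2 * C ^ (1 / 2 : ℝ) := ⟨_, rfl⟩
  have hB0 : 0 ≤ B := by rw [hB]; positivity
  obtain ⟨A, hA⟩ : ∃ A : ℝ, A = 2 + 2 * B := ⟨_, rfl⟩
  have hA0 : 0 < A := by rw [hA]; positivity
  refine ⟨2 * A + B ^ (2 / (2 - θ)), by positivity, fun f hf hpos hper hint => ?_⟩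
  have hfc := hf.continuous
  have hf'c : Continuous (fderiv ℝ f) := hf.continuous_fderiv one_ne_zero
  have hg : ContDiff ℝ 1 (fun x => f x - 1) := hf.sub contDiff_const
  have hfd : ∀ x, fderiv ℝ (fun x => f x - 1) x = fderiv ℝ f x := fun x => by
    rw [fderiv_sub_const]
  have hGN := hC _ hg (fun x m => by simp only [hper])
  simp only [hfd] at hGN
  have hI0 : 0 ≤ ∫ x in unitCube d, ‖fderiv ℝ f x‖ ^ 2 / f x :=
    integral_nonneg fun x => div_nonneg (by positivity) (hpos x).le
  have hX0 : 0 ≤ (∫ x in unitCube d, ‖fderiv ℝ f x‖ ^ q) ^ (1 / q) :=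
    Real.rpow_nonneg (integral_nonneg fun x => by positivity) _
  have hm0 : 0 ≤ ∫ x in unitCube d, |f x - 1| := integral_nonneg fun x => by positivity
  have hm2 : ∫ x in unitCube d, |f x - 1| ≤ 2 := by
    calc ∫ x in unitCube d, |f x - 1| ≤ ∫ x in unitCube d, (f x + 1) := by
          refine integral_mono (uc_int hg.continuous.abs) (uc_int (hfc.add continuous_const)) fun x => ?_
          have := hpos x
          rw [abs_le]; constructor <;> linarith
      _ = 2 := by
          rw [integral_add (uc_int hfc) (uc_int continuous_const), hint]
          simp [measureReal_def, uc_vol]; norm_num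
  -- Hölder
  have hH : ∫ x in unitCube d, ‖fderiv ℝ f x‖ ^ q ≤
      (∫ x in unitCube d, ‖fderiv ℝ f x‖ ^ 2 / f x) ^ (q / 2) *
        (∫ x in unitCube d, f x ^ a) ^ ((2 - q) / 2) := by
    have := uc_holder (d := d) (u := fun x => ‖fderiv ℝ f x‖ ^ 2 / f x) (v := fun x => f x ^ a)
      ((hf'c.norm.pow 2).div hfc fun x => (hpos x).ne')
      (hfc.rpow_const fun _ => Or.inr ha0.le)
      (fun x => div_nonneg (by positivity) (hpos x).le) (fun x => Real.rpow_nonneg (hpos x).le _)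
      (α := q / 2) (β := (2 - q) / 2) (by positivity) (by positivity) (by ring)
    have e : ∀ x, (‖fderiv ℝ f x‖ ^ 2 / f x) ^ (q / 2) * (f x ^ a) ^ ((2 - q) / 2) =
        ‖fderiv ℝ f x‖ ^ q := fun x => by
      have hx := hpos x
      rw [Real.div_rpow (by positivity) hx.le, ← Real.rpow_mul hx.le, ← Real.rpow_natCast,
        ← Real.rpow_mul (norm_nonneg _)]
      have e1 : ((2 : ℕ) : ℝ) * (q / 2) = q := by push_cast; ring
      have e2 : a * ((2 - q) / 2) = q / 2 := by rw [had]; field_simp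
      rw [e1, e2, div_mul_cancel₀ _ (Real.rpow_pos_of_pos hx _).ne']
    simpa only [e] using this
  -- `∫ f^a`
  have hFa0 : 0 ≤ ∫ x in unitCube d, f x ^ a :=
    integral_nonneg fun x => Real.rpow_nonneg (hpos x).le _
  have hG0 : 0 ≤ ∫ x in unitCube d, |f x - 1| ^ a := integral_nonneg fun x => by positivity
  have hFa : ∫ x in unitCube d, f x ^ a ≤ 2 ^ a * ((∫ x in unitCube d, |f x - 1| ^ a) + 1) := by
    have hc : Continuous fun x => |f x - 1| ^ a :=
      hg.continuous.abs.rpow_const fun _ => Or.inr ha0.le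
    calc ∫ x in unitCube d, f x ^ a ≤ ∫ x in unitCube d, 2 ^ a * (|f x - 1| ^ a + 1) := by
          refine integral_mono (uc_int (hfc.rpow_const fun _ => Or.inr ha0.le))
            (uc_int (continuous_const.mul (hc.add continuous_const))) fun x => ?_
          have hx := hpos x
          have hle := le_abs_self (f x - 1)
          have hnn := Real.rpow_nonneg (abs_nonneg (f x - 1)) a
          have h2a : (0 : ℝ) < 2 ^ a := by positivity
          simp only
          rcases le_total |f x - 1| 1 with h | h
          · calc f x ^ a ≤ 2 ^ a := Real.rpow_le_rpow hx.le (by linarith) ha0.le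
              _ ≤ _ := by nlinarith
          · calc f x ^ a ≤ (2 * |f x - 1|) ^ a := Real.rpow_le_rpow hx.le (by linarith) ha0.le
              _ = 2 ^ a * |f x - 1| ^ a := Real.mul_rpow (by norm_num) (abs_nonneg _)
              _ ≤ _ := by nlinarith
      _ = _ := by
          rw [integral_const_mul, integral_add (uc_int hc) (uc_int continuous_const)]
          simp [measureReal_def, uc_vol]
  have hXI : (∫ x in unitCube d, ‖fderiv ℝ f x‖ ^ q) ^ (1 / q) ≤
      (∫ x in unitCube d, ‖fderiv ℝ f x‖ ^ 2 / f x) ^ (1 / 2 : ℝ) *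
        (2 * (((∫ x in unitCube d, |f x - 1| ^ a) ^ (1 / a)) ^ (1 / 2 : ℝ) + 1)) := by
    calc _ ≤ _ := Real.rpow_le_rpow (integral_nonneg fun x => by positivity) hH (by positivity)
      _ = (∫ x in unitCube d, ‖fderiv ℝ f x‖ ^ 2 / f x) ^ (1 / 2 : ℝ) *
          (∫ x in unitCube d, f x ^ a) ^ (1 / (2 * a)) := by
          rw [Real.mul_rpow (by positivity) (by positivity), ← Real.rpow_mul hI0,
            ← Real.rpow_mul hFa0]
          congr 2
          · field_simp
          · rw [had]; field_simp
      _ ≤ _ := by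
          gcongr
          calc _ ≤ (2 ^ a * ((∫ x in unitCube d, |f x - 1| ^ a) + 1)) ^ (1 / (2 * a)) :=
                Real.rpow_le_rpow hFa0 hFa (by positivity)
            _ = 2 ^ (1 / 2 : ℝ) * ((∫ x in unitCube d, |f x - 1| ^ a) + 1) ^ (1 / (2 * a)) := by
                rw [Real.mul_rpow (by positivity) (by positivity), ← Real.rpow_mul (by norm_num)]
                congr 2; field_simp
            _ ≤ 2 * ((∫ x in unitCube d, |f x - 1| ^ a) ^ (1 / (2 * a)) + 1 ^ (1 / (2 * a))) := by
                gcongr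
                · calc (2 : ℝ) ^ (1 / 2 : ℝ) ≤ 2 ^ (1 : ℝ) :=
                        Real.rpow_le_rpow_of_exponent_le (by norm_num) (by norm_num)
                    _ = 2 := Real.rpow_one 2
                · exact two_term_rpow hG0 zero_le_one (by positivity)
                    (by rw [div_le_one (by positivity)]; linarith)
            _ = _ := by
                rw [Real.one_rpow, ← Real.rpow_mul hG0]
                congr 4; field_simp
  have hLa0 : 0 ≤ (∫ x in unitCube d, |f x - 1| ^ a) ^ (1 / a) := by positivity
  generalize (∫ x in unitCube d, ‖fderiv ℝ f x‖ ^ q) ^ (1 / q) = X at *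
  generalize (∫ x in unitCube d, |f x - 1| ^ a) ^ (1 / a) = L at *
  generalize (∫ x in unitCube d, ‖fderiv ℝ f x‖ ^ 2 / f x) = I at *
  generalize (∫ x in unitCube d, |f x - 1|) = m at *
  have h1θ : 0 ≤ 1 - θ := by linarith
  have hL : L ^ (1 / 2 : ℝ) ≤ C ^ (1 / 2 : ℝ) * (X ^ (θ / 2) * m ^ ((1 - θ) / 2) + 2) := by
    calc L ^ (1 / 2 : ℝ) ≤ (C * (X ^ θ * m ^ (1 - θ) + m)) ^ (1 / 2 : ℝ) :=
          Real.rpow_le_rpow hLa0 hGN (by norm_num)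
      _ = C ^ (1 / 2 : ℝ) * (X ^ θ * m ^ (1 - θ) + m) ^ (1 / 2 : ℝ) :=
          Real.mul_rpow hC0 (by positivity)
      _ ≤ C ^ (1 / 2 : ℝ) * ((X ^ θ * m ^ (1 - θ)) ^ (1 / 2 : ℝ) + m ^ (1 / 2 : ℝ)) := by
          gcongr
          exact two_term_rpow (by positivity) hm0 (by norm_num) (by norm_num)
      _ ≤ _ := by
          rw [Real.mul_rpow (by positivity) (by positivity), ← Real.rpow_mul hX0,
            ← Real.rpow_mul hm0, mul_one_div, mul_one_div]
          gcongr
          calc m ^ (1 / 2 : ℝ) ≤ 2 ^ (1 / 2 : ℝ) := Real.rpow_le_rpow hm0 hm2 (by norm_num)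
            _ ≤ 2 ^ (1 : ℝ) := Real.rpow_le_rpow_of_exponent_le (by norm_num) (by norm_num)
            _ = 2 := Real.rpow_one 2
  have hfin : X ≤ A * I ^ (1 / 2 : ℝ) + (B * (I ^ (1 / 2 : ℝ) * m ^ ((1 - θ) / 2))) * X ^ (θ / 2) := by
    calc X ≤ _ := hXI
      _ ≤ I ^ (1 / 2 : ℝ) * (2 * (C ^ (1 / 2 : ℝ) * (X ^ (θ / 2) * m ^ ((1 - θ) / 2) + 2) + 1)) := by
          gcongr
      _ = _ := by rw [hA, hB]; ring
  have hab := absorb hX0 (by positivity) (by positivity) (by linarith) hfin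
  have e1 : 1 / (1 - θ / 2) = 2 / (2 - θ) := by
    have : 1 - θ / 2 ≠ 0 := by linarith
    rw [div_eq_div_iff this h2θ.ne']; ring
  rw [e1, Real.mul_rpow hB0 (by positivity), Real.mul_rpow (by positivity) (by positivity),
    ← Real.rpow_mul hI0, ← Real.rpow_mul hm0] at hab
  have e2 : (1 / 2 : ℝ) * (2 / (2 - θ)) = 1 / (2 - θ) := by field_simp
  have e3 : (1 - θ) / 2 * (2 / (2 - θ)) = (1 - θ) / (2 - θ) := by field_simp
  rw [e2, e3] at hab
  have e4 : A * I ^ (1 / 2 : ℝ) / (1 - θ / 2) ≤ 2 * A * I ^ (1 / 2 : ℝ) := by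
    rw [div_le_iff₀ (by linarith)]
    have : 0 ≤ A * I ^ (1 / 2 : ℝ) := by positivity
    nlinarith
  have p1 : 0 ≤ I ^ (1 / (2 - θ)) * m ^ ((1 - θ) / (2 - θ)) := by positivity
  have p2 : 0 ≤ I ^ (1 / 2 : ℝ) := by positivity
  have p3 : 0 ≤ B ^ (2 / (2 - θ)) := by positivity
  calc X ≤ _ := hab
    _ ≤ 2 * A * I ^ (1 / 2 : ℝ) + B ^ (2 / (2 - θ)) * (I ^ (1 / (2 - θ)) * m ^ ((1 - θ) / (2 - θ))) := by
        linarith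
    _ ≤ _ := by nlinarith [mul_nonneg hA0.le p1, mul_nonneg p3 p2]
end

section
/- Let η > 0 and let a, b, c ∈ ℝ^d with |a−b| ≤ η. Then |log(max(|a−c|, η)) − log(max(|b−c|, η))| ≤ log 2. Moreover, if in addition ε ≥ 4η and |a−c| ≥ ε, then |log(max(|a−c|, η)) − log(max(|b−c|, η))| = |log(|b−c|/|a−c|)| ≤ 2η/ε. -/
theorem aux_two {p q : ℝ} (hp : 0 < p) (hq : 0 < q) (h : p ≤ 2 * q) :
    Real.log p - Real.log q ≤ Real.log 2 := by
  have h1 := Real.log_le_log hp h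
  rw [Real.log_mul (by norm_num) hq.ne'] at h1
  linarith

theorem aux_lin {p q : ℝ} (hp : 0 < p) (hq : 0 < q) :
    Real.log p - Real.log q ≤ (p - q) / q := by
  have h1 := Real.log_le_sub_one_of_pos (div_pos hp hq)
  rw [Real.log_div hp.ne' hq.ne'] at h1
  rw [sub_div, div_self hq.ne']
  exact h1

theorem stmt14 (d : ℕ) (η : ℝ) (hη : 0 < η)
    (a b c : EuclideanSpace ℝ (Fin d)) (hab : ‖a - b‖ ≤ η) :
    |Real.log (max ‖a - c‖ η) - Real.log (max ‖b - c‖ η)| ≤ Real.log 2 ∧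
    ∀ ε : ℝ, 4 * η ≤ ε → ε ≤ ‖a - c‖ →
      |Real.log (max ‖a - c‖ η) - Real.log (max ‖b - c‖ η)| =
          |Real.log (‖b - c‖ / ‖a - c‖)| ∧
        |Real.log (max ‖a - c‖ η) - Real.log (max ‖b - c‖ η)| ≤ 2 * η / ε := by
  have hx : |‖a - c‖ - ‖b - c‖| ≤ η := by
    have h := abs_norm_sub_norm_le (a - c) (b - c)
    rw [sub_sub_sub_cancel_right] at h
    exact h.trans hab
  generalize ‖a - c‖ = x at *
  generalize ‖b - c‖ = y at *
  obtain ⟨h1, h2⟩ := abs_le.1 hx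
  have a1 := le_max_left x η
  have a2 := le_max_right x η
  have b1 := le_max_left y η
  have b2 := le_max_right y η
  have px : 0 < max x η := hη.trans_le a2
  have py : 0 < max y η := hη.trans_le b2
  refine ⟨?_, ?_⟩
  · rw [abs_sub_le_iff]
    exact ⟨aux_two px py (max_le (by linarith) (by linarith)),
      aux_two py px (max_le (by linarith) (by linarith))⟩
  · intro ε he hex
    have hε : 0 < ε := by linarith
    have hx0 : 0 < x := by linarith
    have hy0 : 0 < y := by linarith
    rw [max_eq_left (by linarith : η ≤ x), max_eq_left (by linarith : η ≤ y)]
    refine ⟨?_, ?_⟩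
    · rw [Real.log_div hy0.ne' hx0.ne', abs_sub_comm]
    · rw [abs_sub_le_iff]
      refine ⟨(aux_lin hx0 hy0).trans ?_, (aux_lin hy0 hx0).trans ?_⟩
      · rw [div_le_div_iff₀ hy0 hε]
        nlinarith
      · rw [div_le_div_iff₀ hx0 hε]
        nlinarith
end

section
/- Let d ≥ 1 be an integer and Q := [−1/2, 1/2]^d. There exists a constant C_d > 0, depending only on d, such that for every ε ∈ (0, d), every x ∈ Q, and every measurable function w : Q → [0, ∞) for which w·log w is integrable, one has −∫_Q log|x−y| · w(y) dy ≤ C_d/(d−ε) + (1/ε)·∫_Q w(y)·(log(w(y)/ε) − 1) dy. In particular (taking w ≡ 1 in the logarithmic-kernel bound), ∫_Q |x−y|^{−ε} dy ≤ C_d/(d−ε) for all x ∈ Q and ε ∈ (0, d). -/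
open MeasureTheory

/-- The cube `Q = [-1/2, 1/2]^d` in `ℝ^d`. -/
def centeredCube (d : ℕ) : Set (EuclideanSpace ℝ (Fin d)) :=
  {x | ∀ i, x i ∈ Set.Icc (-(1 : ℝ) / 2) (1 / 2)}

lemma cube_norm_sub_le (d : ℕ) (hd : 1 ≤ d) {x y : EuclideanSpace ℝ (Fin d)}
    (hx : x ∈ centeredCube d) (hy : y ∈ centeredCube d) : ‖x - y‖ ≤ d := by
  have hd' : (1 : ℝ) ≤ d := by exact_mod_cast hd
  have h : ‖x - y‖ ^ 2 ≤ d := by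
    rw [EuclideanSpace.norm_sq_eq]
    calc ∑ i, ‖(x - y) i‖ ^ 2 ≤ ∑ i : Fin d, (1 : ℝ) := by
          refine Finset.sum_le_sum fun i _ => ?_
          have h1 := hx i
          have h2 := hy i
          simp only [Set.mem_Icc] at h1 h2
          rw [PiLp.sub_apply, Real.norm_eq_abs, sq_abs]
          nlinarith
      _ = d := by simp
  nlinarith [norm_nonneg (x - y)]

lemma cube_measurable (d : ℕ) : MeasurableSet (centeredCube d) := by
  have : centeredCube d = ⋂ i, (fun x : EuclideanSpace ℝ (Fin d) => x i) ⁻¹'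
      Set.Icc (-(1 : ℝ) / 2) (1 / 2) := by
    ext x; simp [centeredCube]
  rw [this]
  refine MeasurableSet.iInter fun i => ?_
  exact measurableSet_Icc.preimage (by fun_prop)

lemma cube_subset_ball (d : ℕ) (hd : 1 ≤ d) {x : EuclideanSpace ℝ (Fin d)}
    (hx : x ∈ centeredCube d) : centeredCube d ⊆ Metric.ball x (d + 1) := by
  intro y hy
  rw [Metric.mem_ball, dist_comm, dist_eq_norm]
  linarith [cube_norm_sub_le d hd hx hy]

lemma kernel_radial (d : ℕ) (hd : 1 ≤ d) (ε : ℝ) (h0 : 0 < ε) (h1 : ε < d) :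
    Integrable (fun z : EuclideanSpace ℝ (Fin d) =>
      (Set.Iio ((d : ℝ) + 1)).indicator (fun r : ℝ => r ^ (-ε)) ‖z‖) ∧
    (∫ z : EuclideanSpace ℝ (Fin d),
      (Set.Iio ((d : ℝ) + 1)).indicator (fun r : ℝ => r ^ (-ε)) ‖z‖) ≤
      (d * volume.real (Metric.ball (0 : EuclideanSpace ℝ (Fin d)) 1) * ((d : ℝ) + 1) ^ d) /
        (d - ε) := by
  have : NeZero d := ⟨by omega⟩
  have : Nontrivial (EuclideanSpace ℝ (Fin d)) := by
    have : Nonempty (Fin d) := ⟨0⟩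
    infer_instance
  have hR : (0 : ℝ) ≤ d + 1 := by positivity
  have hq : (-1 : ℝ) < d - 1 - ε := by linarith
  have key : ∀ y ∈ Set.Ioi (0 : ℝ),
      y ^ (d - 1) • (Set.Iio ((d : ℝ) + 1)).indicator (fun r : ℝ => r ^ (-ε)) y =
      (Set.Iio ((d : ℝ) + 1)).indicator (fun r : ℝ => r ^ ((d : ℝ) - 1 - ε)) y := by
    intro y hy
    have hy : 0 < y := hy
    by_cases hy' : y < d + 1
    · rw [Set.indicator_of_mem (by exact hy'), Set.indicator_of_mem (by exact hy'), smul_eq_mul,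
        ← Real.rpow_natCast, ← Real.rpow_add hy]
      congr 1
      push_cast [Nat.cast_sub hd]
      ring
    · rw [Set.indicator_of_notMem (by exact hy'), Set.indicator_of_notMem (by exact hy'), smul_zero]
  have hii := (intervalIntegral.intervalIntegrable_rpow' (a := 0) (b := (d : ℝ) + 1) hq)
  rw [intervalIntegrable_iff_integrableOn_Ioo_of_le hR] at hii
  constructor
  · rw [integrable_fun_norm_addHaar volume, finrank_euclideanSpace_fin,
      integrableOn_congr_fun key measurableSet_Ioi]
    rw [IntegrableOn, integrable_indicator_iff measurableSet_Iio, IntegrableOn,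
      Measure.restrict_restrict measurableSet_Iio, Set.inter_comm, Set.Ioi_inter_Iio]
    exact hii
  · rw [integral_fun_norm_addHaar volume, finrank_euclideanSpace_fin,
      setIntegral_congr_fun measurableSet_Ioi key, setIntegral_indicator measurableSet_Iio,
      Set.Ioi_inter_Iio, ← integral_Ioc_eq_integral_Ioo,
      ← intervalIntegral.integral_of_le hR, integral_rpow (Or.inl hq), nsmul_eq_mul, smul_eq_mul]
    have e : (d : ℝ) - 1 - ε + 1 = d - ε := by ring
    have hp : (0 : ℝ) < d - ε := by linarith
    rw [e, Real.zero_rpow hp.ne', sub_zero, mul_div_assoc, ← mul_assoc]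
    gcongr
    rw [← Real.rpow_natCast]
    apply Real.rpow_le_rpow_of_exponent_le
    · have : (0 : ℝ) ≤ d := by positivity
      linarith
    · linarith

lemma kernel_bound (d : ℕ) (hd : 1 ≤ d) (ε : ℝ) (h0 : 0 < ε) (h1 : ε < d)
    (x : EuclideanSpace ℝ (Fin d)) (hx : x ∈ centeredCube d) :
    IntegrableOn (fun y => ‖x - y‖ ^ (-ε)) (centeredCube d) ∧
    (∫ y in centeredCube d, ‖x - y‖ ^ (-ε)) ≤
      (d * volume.real (Metric.ball (0 : EuclideanSpace ℝ (Fin d)) 1) * ((d : ℝ) + 1) ^ d) /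
        (d - ε) := by
  obtain ⟨hi, hb⟩ := kernel_radial d hd ε h0 h1
  have hi' := hi.comp_sub_left x
  have hb' := hb
  rw [← integral_sub_left_eq_self _ volume x] at hb'
  have key : ∀ y ∈ centeredCube d,
      (Set.Iio ((d : ℝ) + 1)).indicator (fun r : ℝ => r ^ (-ε)) ‖x - y‖ = ‖x - y‖ ^ (-ε) := by
    intro y hy
    apply Set.indicator_of_mem
    have := cube_norm_sub_le d hd hx hy
    simp only [Set.mem_Iio]
    linarith
  constructor
  · exact (integrableOn_congr_fun key (cube_measurable d)).1 hi'.integrableOn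
  · rw [← setIntegral_congr_fun (cube_measurable d) key]
    refine le_trans (setIntegral_le_integral hi' ?_) hb'
    filter_upwards with y
    exact Set.indicator_apply_nonneg (fun _ => Real.rpow_nonneg (norm_nonneg _) _)

lemma fenchel_ineq (a b : ℝ) (hb : 0 ≤ b) : a * b ≤ Real.exp a + b * (Real.log b - 1) := by
  rcases hb.eq_or_lt with rfl | hb
  · simp [Real.exp_nonneg]
  · have h := Real.add_one_le_exp (a - Real.log b)
    rw [Real.exp_sub, Real.exp_log hb, le_div_iff₀ hb] at h
    linarith

theorem stmt15 (d : ℕ) (hd : 1 ≤ d) :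
    ∃ C : ℝ, 0 < C ∧
      (∀ ε : ℝ, 0 < ε → ε < d → ∀ x ∈ centeredCube d,
        ∀ w : EuclideanSpace ℝ (Fin d) → ℝ,
          Measurable w → (∀ y, 0 ≤ w y) →
          IntegrableOn (fun y => w y * Real.log (w y)) (centeredCube d) →
          (-∫ y in centeredCube d, Real.log ‖x - y‖ * w y) ≤
            C / ((d : ℝ) - ε) +
              (1 / ε) * ∫ y in centeredCube d, w y * (Real.log (w y / ε) - 1)) ∧
      (∀ ε : ℝ, 0 < ε → ε < d → ∀ x ∈ centeredCube d,
        (∫ y in centeredCube d, ‖x - y‖ ^ (-ε)) ≤ C / ((d : ℝ) - ε)) := by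
  have : NeZero d := ⟨by omega⟩
  have : Nontrivial (EuclideanSpace ℝ (Fin d)) := by
    have : Nonempty (Fin d) := ⟨0⟩
    infer_instance
  refine ⟨d * volume.real (Metric.ball (0 : EuclideanSpace ℝ (Fin d)) 1) * ((d : ℝ) + 1) ^ d,
    ?_, ?_, fun ε h0 h1 x hx => (kernel_bound d hd ε h0 h1 x hx).2⟩
  · have hv : 0 < volume.real (Metric.ball (0 : EuclideanSpace ℝ (Fin d)) 1) :=
      ENNReal.toReal_pos (Metric.measure_ball_pos _ _ one_pos).ne' measure_ball_lt_top.ne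
    have hd' : (0 : ℝ) < d := by exact_mod_cast hd
    positivity
  intro ε h0 h1 x hx w hw hw0 hint
  obtain ⟨hk, hkb⟩ := kernel_bound d hd ε h0 h1 x hx
  have hQfin : volume (centeredCube d) ≠ ⊤ :=
    ((measure_mono (cube_subset_ball d hd hx)).trans_lt measure_ball_lt_top).ne
  -- `w` is integrable
  have hwi : IntegrableOn w (centeredCube d) := by
    have hg : IntegrableOn (fun y => Real.exp 1 + |w y * Real.log (w y)|) (centeredCube d) :=
      (integrableOn_const hQfin).add hint.abs
    refine Integrable.mono' hg hw.aestronglyMeasurable ?_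
    filter_upwards with y
    rw [Real.norm_eq_abs, abs_of_nonneg (hw0 y)]
    by_cases h : w y ≤ Real.exp 1
    · linarith [abs_nonneg (w y * Real.log (w y))]
    · push Not at h
      have : 1 ≤ Real.log (w y) := by
        rw [Real.le_log_iff_exp_le ((Real.exp_pos 1).trans h)]
        exact h.le
      have h2 := le_abs_self (w y * Real.log (w y))
      nlinarith [hw0 y, Real.exp_pos 1]
  have hent : IntegrableOn (fun y => w y * (Real.log (w y / ε) - 1)) (centeredCube d) := by
    have : (fun y => w y * (Real.log (w y / ε) - 1)) =
        fun y => w y * Real.log (w y) - (Real.log ε + 1) * w y := by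
      funext y
      rcases (hw0 y).eq_or_lt with h | h
      · simp [← h]
      · rw [Real.log_div h.ne' h0.ne']
        ring
    rw [this]
    exact hint.sub (hwi.const_mul _)
  have hne : ∀ᵐ y ∂(volume.restrict (centeredCube d)), y ≠ x :=
    ae_restrict_of_ae (Measure.ae_ne volume x)
  have hpt : ∀ᵐ y ∂(volume.restrict (centeredCube d)),
      -(Real.log ‖x - y‖ * w y) ≤
        ‖x - y‖ ^ (-ε) + (1 / ε) * (w y * (Real.log (w y / ε) - 1)) := by
    filter_upwards [hne] with y hy
    have hr : 0 < ‖x - y‖ := norm_pos_iff.2 (sub_ne_zero.2 hy.symm)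
    have hf := fenchel_ineq (Real.log ‖x - y‖ * (-ε)) (w y / ε) (div_nonneg (hw0 y) h0.le)
    rw [← Real.rpow_def_of_pos hr] at hf
    have e1 : Real.log ‖x - y‖ * (-ε) * (w y / ε) = -(Real.log ‖x - y‖ * w y) := by
      field_simp
    rw [e1] at hf
    calc _ ≤ _ := hf
      _ = _ := by ring
  have hrhs : IntegrableOn (fun y => ‖x - y‖ ^ (-ε) +
      (1 / ε) * (w y * (Real.log (w y / ε) - 1))) (centeredCube d) := hk.add (hent.const_mul _)
  have hlhs : IntegrableOn (fun y => -(Real.log ‖x - y‖ * w y)) (centeredCube d) := by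
    have hm : Measurable (fun y => -(Real.log ‖x - y‖ * w y)) := by fun_prop
    refine Integrable.mono' (hrhs.abs.add (hwi.const_mul (d : ℝ))) hm.aestronglyMeasurable ?_
    filter_upwards [hpt, ae_restrict_mem (cube_measurable d)] with y hy hyQ
    have hl : Real.log ‖x - y‖ ≤ d :=
      (Real.log_le_self (norm_nonneg _)).trans (cube_norm_sub_le d hd hx hyQ)
    have hl' := mul_le_mul_of_nonneg_right hl (hw0 y)
    have hdw : 0 ≤ (d : ℝ) * w y := mul_nonneg (by positivity) (hw0 y)
    have ha := le_abs_self (‖x - y‖ ^ (-ε) + (1 / ε) * (w y * (Real.log (w y / ε) - 1)))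
    have ha' := abs_nonneg (‖x - y‖ ^ (-ε) + (1 / ε) * (w y * (Real.log (w y / ε) - 1)))
    rw [Real.norm_eq_abs, abs_le]
    simp only [Pi.add_apply]
    constructor <;> linarith
  rw [← integral_neg]
  calc _ ≤ ∫ y in centeredCube d, (‖x - y‖ ^ (-ε) +
        (1 / ε) * (w y * (Real.log (w y / ε) - 1))) := integral_mono_ae hlhs hrhs hpt
    _ = (∫ y in centeredCube d, ‖x - y‖ ^ (-ε)) +
        (1 / ε) * ∫ y in centeredCube d, w y * (Real.log (w y / ε) - 1) := by
      rw [integral_add hk (hent.const_mul _), integral_const_mul]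
    _ ≤ _ := by gcongr
end

section
/- Let d ≥ 1 be an integer, set c_d := Γ(d/2)(4π)^{d/2}/2 and β_s := (2π)^d/c_d, and for β > 0 and k ∈ ℤ^d∖{0} set λ_{β,|k|} := c_d(2π|k|)^{2−d} − (4π²/β)|k|². Then: (i) if 0 < β ≤ β_s, then λ_{β,|k|} ≤ 0 for every k ∈ ℤ^d∖{0}; (ii) if β > β_s, then λ_{β,|k|} > 0 for every k with |k| = 1. -/
/-- The constant `c_d = Γ(d/2)(4π)^{d/2}/2`. -/
noncomputable def cd (d : ℕ) : ℝ := Real.Gamma ((d : ℝ) / 2) * (4 * Real.pi) ^ ((d : ℝ) / 2) / 2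

/-- The stability threshold `β_s = (2π)^d / c_d`. -/
noncomputable def betaS (d : ℕ) : ℝ := (2 * Real.pi) ^ d / cd d

/-- The Euclidean norm `|k|` of `k ∈ ℤ^d`. -/
noncomputable def znorm (d : ℕ) (k : Fin d → ℤ) : ℝ := Real.sqrt (∑ i, ((k i : ℝ)) ^ 2)

/-- The eigenvalue `λ_{β,|k|} = c_d (2π|k|)^{2-d} - (4π²/β)|k|²` of the linearization `L_β`
about the uniform distribution, on the Fourier mode `e^{2πik·x}`. -/
noncomputable def lambdaEig (d : ℕ) (β : ℝ) (k : Fin d → ℤ) : ℝ :=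
  cd d * (2 * Real.pi * znorm d k) ^ ((2 : ℝ) - d) - (4 * Real.pi ^ 2 / β) * (znorm d k) ^ 2

lemma cd_pos_aux (d : ℕ) (hd : 1 ≤ d) : 0 < cd d := by
  have h : (0 : ℝ) < (d : ℝ) / 2 := by
    have : (0 : ℝ) < d := by exact_mod_cast hd
    positivity
  have h1 := Real.Gamma_pos_of_pos h
  unfold cd
  have := Real.pi_pos
  positivity

lemma lambdaEig_eq_aux (d : ℕ) (β : ℝ) (hβ : 0 < β) (k : Fin d → ℤ) (hk : 0 < znorm d k) :
    lambdaEig d β k = (2 * Real.pi * znorm d k) ^ 2 *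
      ((cd d * β - (2 * Real.pi * znorm d k) ^ d) / ((2 * Real.pi * znorm d k) ^ d * β)) := by
  have hpi := Real.pi_pos
  have hA : 0 < 2 * Real.pi * znorm d k := by positivity
  unfold lambdaEig
  rw [Real.rpow_sub hA, Real.rpow_natCast, Real.rpow_two]
  have hAd : 0 < (2 * Real.pi * znorm d k) ^ d := by positivity
  generalize hD : (2 * Real.pi * znorm d k) ^ d = D at *
  field_simp
  ring

lemma one_le_znorm_aux (d : ℕ) (k : Fin d → ℤ) (hk : k ≠ 0) : 1 ≤ znorm d k := by
  obtain ⟨i, hi⟩ := Function.ne_iff.mp hk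
  unfold znorm
  rw [Real.one_le_sqrt]
  have h1 : (1 : ℝ) ≤ (k i : ℝ) ^ 2 := by
    have : (1 : ℤ) ≤ (k i) ^ 2 := by
      have : 0 < (k i) ^ 2 := by
        have : k i ≠ 0 := hi
        positivity
      omega
    exact_mod_cast this
  exact h1.trans (Finset.single_le_sum (f := fun i => (k i : ℝ) ^ 2)
    (fun j _ => sq_nonneg _) (Finset.mem_univ i))

theorem stmt19 (d : ℕ) (hd : 1 ≤ d) (β : ℝ) (hβ : 0 < β) :
    (β ≤ betaS d → ∀ k : Fin d → ℤ, k ≠ 0 → lambdaEig d β k ≤ 0) ∧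
    (betaS d < β → ∀ k : Fin d → ℤ, znorm d k = 1 → 0 < lambdaEig d β k) := by
  have hc := cd_pos_aux d hd
  have hpi := Real.pi_pos
  constructor
  · intro h k hk
    have h1 := one_le_znorm_aux d k hk
    have h0 : 0 < znorm d k := by linarith
    rw [lambdaEig_eq_aux d β hβ k h0]
    unfold betaS at h
    rw [le_div_iff₀ hc] at h
    have h2 : (2 * Real.pi) ^ d ≤ (2 * Real.pi * znorm d k) ^ d := by
      apply pow_le_pow_left₀ (by positivity)
      nlinarith
    apply mul_nonpos_of_nonneg_of_nonpos (by positivity)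
    apply div_nonpos_of_nonpos_of_nonneg
    · nlinarith
    · positivity
  · intro h k hk
    rw [lambdaEig_eq_aux d β hβ k (by rw [hk]; norm_num), hk, mul_one]
    unfold betaS at h
    rw [div_lt_iff₀ hc] at h
    have : 0 < cd d * β - (2 * Real.pi) ^ d := by nlinarith
    positivity
end
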